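/- Let a < b be real numbers, f a bivariate real polynomial, and p₁, p₂ univariate real polynomials. If (aeval ![p₁,p₂] f).eval t = 0 for every t ∈ [a,b], then for every t ∈ ℝ, (aeval ![p₁,p₂] (pderiv 0 f)).eval t * (derivative p₁).eval t + (aeval ![p₁,p₂] (pderiv 1 f)).eval t * (derivative p₂).eval t = 0. -/

import Mathlib

open Polynomial MvPolynomial

/-- The chain rule for the derivative of a polynomial composition `f(p₁, …, pₙ)`. -/
theorem MvPolynomial.derivative_aeval {R σ : Type*} [CommRing R] [Fintype σ]
    (p : σ → Polynomial R) (f : MvPolynomial σ R) :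
    Polynomial.derivative (MvPolynomial.aeval p f) =
      ∑ i, MvPolynomial.aeval p (MvPolynomial.pderiv i f) * Polynomial.derivative (p i) := by
  classical
  induction f using MvPolynomial.induction_on with
  | C a => simp [Polynomial.algebraMap_eq]
  | add f g hf hg => simp only [map_add, hf, hg, add_mul, Finset.sum_add_distrib]
  | mul_X f j hf =>
    have hsum : ∑ i, MvPolynomial.aeval p f * MvPolynomial.aeval p (MvPolynomial.pderiv i
        (MvPolynomial.X j : MvPolynomial σ R)) * Polynomial.derivative (p i) =
        MvPolynomial.aeval p f * Polynomial.derivative (p j) := by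
      rw [Finset.sum_eq_single j]
      · simp
      · intro i _ hij
        simp [MvPolynomial.pderiv_X_of_ne hij.symm]
      · simp
    simp only [map_mul, MvPolynomial.aeval_X, Polynomial.derivative_mul, hf,
      MvPolynomial.pderiv_mul, map_add, add_mul, Finset.sum_add_distrib, hsum,
      Finset.sum_mul, mul_right_comm]

/-- An exact implicitization (i.e. `f ∘ p` vanishes on `[a,b]`) has vanishing weak gradient
constraint: `∇f(p(t)) · p'(t) = 0` for every real `t`. -/
theorem exact_implicitization_weak_gradient_vanishes
    (a b : ℝ) (hab : a < b)
    (f : MvPolynomial (Fin 2) ℝ) (p₁ p₂ : Polynomial ℝ)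
    (h : ∀ t ∈ Set.Icc a b, (MvPolynomial.aeval ![p₁, p₂] f).eval t = 0) :
    ∀ t : ℝ,
      (MvPolynomial.aeval ![p₁, p₂] (MvPolynomial.pderiv 0 f)).eval t
          * (Polynomial.derivative p₁).eval t
        + (MvPolynomial.aeval ![p₁, p₂] (MvPolynomial.pderiv 1 f)).eval t
          * (Polynomial.derivative p₂).eval t = 0 := by
  have hzero : MvPolynomial.aeval ![p₁, p₂] f = 0 :=
    Polynomial.eq_zero_of_infinite_isRoot _ ((Set.Icc_infinite hab).mono h)
  intro t
  have hchain := congrArg (Polynomial.eval t) (MvPolynomial.derivative_aeval ![p₁, p₂] f)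
  simpa [hzero, Fin.sum_univ_two] using hchain.symm
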